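/- Assume Δ > 0, η ≤ Δ²/(36·λ₁*³), and X₀ ∈ R. Then for all t ≥ 0 the noise-to-signal ratio contracts: σ₁(J_{t+1})²/σ_r(U_{t+1})² ≤ (1 − ηΔ/3)·σ₁(J_t)²/σ_r(U_t)². Consequently, σ₁(J_t)² ≤ (8·λ₁*²/Δ)·(1 − ηΔ/3)^t for all t ≥ 0. -/

import Mathlib

open Matrix

/-- The largest singular value of a real matrix. -/
noncomputable def sigmaMax {m n : ℕ} (M : Matrix (Fin m) (Fin n) ℝ) : ℝ :=
  sSup {c : ℝ | ∃ v : EuclideanSpace ℝ (Fin n), ‖v‖ = 1 ∧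
    c = ‖(EuclideanSpace.equiv (Fin m) ℝ).symm (M.mulVec ((EuclideanSpace.equiv (Fin n) ℝ) v))‖}

/-- The smallest singular value (the `n`-th largest, for a matrix with `n` columns). -/
noncomputable def sigmaMin {m n : ℕ} (M : Matrix (Fin m) (Fin n) ℝ) : ℝ :=
  sInf {c : ℝ | ∃ v : EuclideanSpace ℝ (Fin n), ‖v‖ = 1 ∧
    c = ‖(EuclideanSpace.equiv (Fin m) ℝ).symm (M.mulVec ((EuclideanSpace.equiv (Fin n) ℝ) v))‖}

/-- Frobenius norm of a real matrix. -/
noncomputable def frobNorm {m n : ℕ} (M : Matrix (Fin m) (Fin n) ℝ) : ℝ :=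
  Real.sqrt (∑ i, ∑ j, (M i j) ^ 2)

/-- Gradient descent iterates `X_{t+1} = X_t + η (Σ - X_t X_tᵀ) X_t`. -/
noncomputable def gdIter {d r : ℕ} (S : Matrix (Fin d) (Fin d) ℝ) (η : ℝ)
    (X0 : Matrix (Fin d) (Fin r) ℝ) : ℕ → Matrix (Fin d) (Fin r) ℝ
  | 0 => X0
  | t + 1 => gdIter S η X0 t +
      η • ((S - gdIter S η X0 t * (gdIter S η X0 t)ᵀ) * gdIter S η X0 t)

/-- The top `r × r` block `U` (first `r` rows) of `X ∈ ℝ^{d×r}`. -/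
def topBlock {d r : ℕ} (h : r ≤ d) (X : Matrix (Fin d) (Fin r) ℝ) :
    Matrix (Fin r) (Fin r) ℝ :=
  fun i j => X (Fin.castLE h i) j

/-- The bottom `(d-r) × r` block `J` (last `d-r` rows) of `X ∈ ℝ^{d×r}`. -/
def botBlock {d r : ℕ} (X : Matrix (Fin d) (Fin r) ℝ) :
    Matrix (Fin (d - r)) (Fin r) ℝ :=
  fun i j => X ⟨r + (i : ℕ), by have := i.isLt; omega⟩ j

/-- The region `R = {X : σ₁(X)² ≤ 2λ₁*, σ₁(J)² ≤ λ_r* − Δ/2, σ_r(U)² ≥ Δ/4}`. -/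
def inR {d r : ℕ} (h : r ≤ d) (lam1 lamr Δ : ℝ) (X : Matrix (Fin d) (Fin r) ℝ) : Prop :=
  sigmaMax X ^ 2 ≤ 2 * lam1 ∧ sigmaMax (botBlock X) ^ 2 ≤ lamr - Δ / 2 ∧
    Δ / 4 ≤ sigmaMin (topBlock h X) ^ 2

/-- The region `R₂ = {X : σ₁(X)² ≤ 2λ₁*, σ₁(J)² ≤ λ_r* − Δ/2}`. -/
def inR2 {d r : ℕ} (lam1 lamr Δ : ℝ) (X : Matrix (Fin d) (Fin r) ℝ) : Prop :=
  sigmaMax X ^ 2 ≤ 2 * lam1 ∧ sigmaMax (botBlock X) ^ 2 ≤ lamr - Δ / 2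

section Abstract
open scoped InnerProductSpace

variable {E F G : Type*} [NormedAddCommGroup E] [InnerProductSpace ℝ E] [FiniteDimensional ℝ E]
  [NormedAddCommGroup F] [InnerProductSpace ℝ F] [FiniteDimensional ℝ F]
  [NormedAddCommGroup G] [InnerProductSpace ℝ G] [FiniteDimensional ℝ G]

open LinearMap (adjoint)

theorem norm_adjoint_apply_self_le {A : E →ₗ[ℝ] F} {y : ℝ} (hy : 0 ≤ y)
    (hA : ∀ v, ‖A v‖ ^ 2 ≤ y * ‖v‖ ^ 2) (v : E) : ‖adjoint A (A v)‖ ≤ y * ‖v‖ := by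
  set q := adjoint A (A v) with hq
  have h1 : ‖q‖ ^ 2 ≤ ‖A q‖ * ‖A v‖ := by
    rw [← real_inner_self_eq_norm_sq]
    nth_rewrite 2 [hq]
    rw [LinearMap.adjoint_inner_right]
    exact real_inner_le_norm _ _
  have h2 : (‖A q‖ * ‖A v‖) ^ 2 ≤ (y * (‖q‖ * ‖v‖)) ^ 2 := by
    calc (‖A q‖ * ‖A v‖) ^ 2 = ‖A q‖ ^ 2 * ‖A v‖ ^ 2 := by ring
      _ ≤ (y * ‖q‖ ^ 2) * (y * ‖v‖ ^ 2) := by gcongr <;> apply hA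
      _ = _ := by ring
  have h3 := le_of_sq_le_sq h2 (by positivity)
  have h4 : ‖q‖ * ‖q‖ ≤ y * ‖v‖ * ‖q‖ := by nlinarith
  rcases (norm_nonneg q).eq_or_lt with h | h
  · rw [← h]; positivity
  · exact le_of_mul_le_mul_right h4 h

theorem norm_apply_adjoint_le {A : E →ₗ[ℝ] F} {y : ℝ} (hy : 0 ≤ y)
    (hA : ∀ v, ‖A v‖ ^ 2 ≤ y * ‖v‖ ^ 2) (u : F) : ‖A (adjoint A u)‖ ≤ y * ‖u‖ := by
  have h1 : ‖adjoint A u‖ ^ 2 ≤ ‖A (adjoint A u)‖ * ‖u‖ := by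
    rw [← real_inner_self_eq_norm_sq, LinearMap.adjoint_inner_right]
    exact real_inner_le_norm _ _
  have h2 := hA (adjoint A u)
  have h4 : ‖A (adjoint A u)‖ * ‖A (adjoint A u)‖ ≤ y * ‖u‖ * ‖A (adjoint A u)‖ := by
    nlinarith [mul_le_mul_of_nonneg_left h1 hy]
  rcases (norm_nonneg (A (adjoint A u))).eq_or_lt with h | h
  · rw [← h]; positivity
  · exact le_of_mul_le_mul_right h4 h

theorem inner_adjoint_apply_self (A : E →ₗ[ℝ] F) (v : E) :
    ⟪adjoint A (A v), v⟫_ℝ = ‖A v‖ ^ 2 := by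
  rw [LinearMap.adjoint_inner_left, real_inner_self_eq_norm_sq]

theorem inner_apply_apply_adjoint (A : E →ₗ[ℝ] F) (v : E) :
    ⟪A v, A (adjoint A (A v))⟫_ℝ = ‖adjoint A (A v)‖ ^ 2 := by
  rw [← LinearMap.adjoint_inner_left, real_inner_self_eq_norm_sq]

/-- The map `A (b - η AᵀA)` has norm at most `√y (b - η y)` when `‖A‖² ≤ y` and `4 η y ≤ b`. -/
theorem norm_smul_sub_cubic_sq_le {A : E →ₗ[ℝ] F} {y b η : ℝ} (hy : 0 ≤ y) (hη : 0 ≤ η)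
    (hb : 4 * (η * y) ≤ b) (hA : ∀ v, ‖A v‖ ^ 2 ≤ y * ‖v‖ ^ 2) (v : E) :
    ‖b • A v - η • A (adjoint A (A v))‖ ^ 2 ≤ y * (b - η * y) ^ 2 * ‖v‖ ^ 2 := by
  have hηy : 0 ≤ η * y := mul_nonneg hη hy
  rw [norm_sub_sq_real, inner_smul_left, inner_smul_right, inner_apply_apply_adjoint,
    norm_smul, norm_smul, mul_pow, mul_pow, Real.norm_eq_abs, Real.norm_eq_abs, sq_abs, sq_abs]
  have h1 := hA (adjoint A (A v))
  have h2 := hA v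
  have h3 : 0 ≤ ‖adjoint A (A v) - y • v‖ ^ 2 := sq_nonneg _
  rw [norm_sub_sq_real, inner_smul_right, inner_adjoint_apply_self, norm_smul, mul_pow,
    Real.norm_eq_abs, sq_abs] at h3
  set a := ‖A v‖ ^ 2
  set c := ‖adjoint A (A v)‖ ^ 2
  set n := ‖v‖ ^ 2
  simp only [conj_trivial]
  have k1 := mul_le_mul_of_nonneg_left h1 (sq_nonneg η)
  have k2 : 0 ≤ (η * (2 * b - η * y)) * (c - 2 * (y * a) + y ^ 2 * n) :=
    mul_nonneg (mul_nonneg hη (by linarith)) h3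
  have k3 : 0 ≤ (b ^ 2 - 4 * b * (η * y) + 2 * (η * y) ^ 2) * (y * n - a) :=
    mul_nonneg (by nlinarith) (by linarith)
  nlinarith

theorem norm_adjoint_apply_self_sq_le {A : E →ₗ[ℝ] F} {y T : ℝ} (hyT : y < T)
    (hlow : ∀ v, y * ‖v‖ ^ 2 ≤ ‖A v‖ ^ 2) (hup : ∀ v, ‖A v‖ ^ 2 ≤ T * ‖v‖ ^ 2) (v : E) :
    ‖adjoint A (A v)‖ ^ 2 ≤ (T + y) * ‖A v‖ ^ 2 - T * y * ‖v‖ ^ 2 := by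
  have h1 := hup (adjoint A (A v) - y • v)
  have h2 := hlow (T • v - adjoint A (A v))
  simp only [map_sub, map_smul, norm_sub_sq_real, inner_smul_right, inner_smul_left,
    inner_adjoint_apply_self, inner_apply_apply_adjoint, norm_smul, mul_pow, Real.norm_eq_abs,
    sq_abs, conj_trivial, real_inner_comm (A v), real_inner_comm (adjoint A (A v)) v] at h1 h2
  have : 0 < T - y := sub_pos.2 hyT
  refine le_of_mul_le_mul_left ?_ this
  nlinarith

/-- The map `A (1 - η AᵀA)` is bounded below by `√y (1 - η y)` when `y ≤ AᵀA`. -/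
theorem le_norm_sub_cubic_sq {A : E →ₗ[ℝ] F} {y T η : ℝ} (hy : 0 ≤ y) (hη : 0 ≤ η)
    (hyT : y < T) (hT : 2 * η * (T + y) ≤ 1)
    (hlow : ∀ v, y * ‖v‖ ^ 2 ≤ ‖A v‖ ^ 2) (hup : ∀ v, ‖A v‖ ^ 2 ≤ T * ‖v‖ ^ 2) (v : E) :
    y * (1 - η * y) ^ 2 * ‖v‖ ^ 2 ≤ ‖A v - η • A (adjoint A (A v))‖ ^ 2 := by
  have h1 := hlow (adjoint A (A v))
  have h2 := norm_adjoint_apply_self_sq_le hyT hlow hup v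
  have h3 := hlow v
  rw [norm_sub_sq_real, inner_smul_right, inner_apply_apply_adjoint, norm_smul, mul_pow,
    Real.norm_eq_abs, sq_abs]
  set a := ‖A v‖ ^ 2
  set c := ‖adjoint A (A v)‖ ^ 2
  set n := ‖v‖ ^ 2
  have hηy : 0 ≤ η * y := mul_nonneg hη hy
  have hηyT : η * y ≤ η * T := mul_le_mul_of_nonneg_left hyT.le hη
  have k1 := mul_le_mul_of_nonneg_left h1 (sq_nonneg η)
  have hc : 0 ≤ η * (2 - η * y) := mul_nonneg hη (by nlinarith)
  have k2 := mul_le_mul_of_nonneg_left h2 hc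
  have k3 : 0 ≤ (1 - η * (2 - η * y) * (T + y)) * (a - y * n) := by
    refine mul_nonneg ?_ (by linarith)
    nlinarith [mul_nonneg hηy (add_nonneg (hηy.trans hηyT) hηy)]
  nlinarith

theorem norm_smul_sub_adjoint_sq_le {A : E →ₗ[ℝ] F} {y T a η : ℝ} (hη : 0 ≤ η)
    (hyT : y < T) (ha : η * (T + y) ≤ 2 * a)
    (hlow : ∀ v, y * ‖v‖ ^ 2 ≤ ‖A v‖ ^ 2) (hup : ∀ v, ‖A v‖ ^ 2 ≤ T * ‖v‖ ^ 2) (v : E) :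
    ‖a • v - η • adjoint A (A v)‖ ^ 2 ≤ ((a - η * y) * ‖v‖) ^ 2 := by
  have h2 := norm_adjoint_apply_self_sq_le hyT hlow hup v
  have h3 := hlow v
  rw [norm_sub_sq_real, inner_smul_right, inner_smul_left, real_inner_comm,
    inner_adjoint_apply_self, norm_smul, norm_smul, mul_pow, mul_pow, Real.norm_eq_abs,
    Real.norm_eq_abs, sq_abs, sq_abs, mul_pow]
  simp only [conj_trivial]
  set p := ‖A v‖ ^ 2
  set c := ‖adjoint A (A v)‖ ^ 2
  set n := ‖v‖ ^ 2
  have k2 := mul_le_mul_of_nonneg_left h2 (sq_nonneg η)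
  have k3 : 0 ≤ η * (2 * a - η * (T + y)) * (p - y * n) :=
    mul_nonneg (mul_nonneg hη (by linarith)) (by linarith)
  nlinarith

/-- Upper bound for one gradient step on the bottom block. -/
theorem norm_gd_step_le {U : E →ₗ[ℝ] F} {J : E →ₗ[ℝ] G} {S : G →ₗ[ℝ] G} {η T s j m : ℝ}
    (hη : 0 ≤ η) (hs : 0 ≤ s) (hj : 0 ≤ j) (hsT : s ^ 2 < T) (hT : η * T ≤ 1 / 8)
    (hjT : j ^ 2 ≤ T) (hS : ∀ y, ‖S y‖ ≤ m * ‖y‖) (hm : 0 ≤ m)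
    (hJ : ∀ v, ‖J v‖ ≤ j * ‖v‖) (hU : ∀ v, s * ‖v‖ ≤ ‖U v‖)
    (hU' : ∀ v, ‖U v‖ ^ 2 ≤ T * ‖v‖ ^ 2) (v : E) :
    ‖J v + η • (S (J v) - J (adjoint U (U v) + adjoint J (J v)))‖ ≤
      j * (1 + η * m - η * s ^ 2 - η * j ^ 2) * ‖v‖ := by
  have hsT' : η * s ^ 2 ≤ η * T := mul_le_mul_of_nonneg_left hsT.le hη
  have hjT' : η * j ^ 2 ≤ η * T := mul_le_mul_of_nonneg_left hjT hη
  have hJ2 : ∀ v, ‖J v‖ ^ 2 ≤ j ^ 2 * ‖v‖ ^ 2 := fun v => by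
    rw [← mul_pow]; exact pow_le_pow_left₀ (norm_nonneg _) (hJ v) 2
  have hU2 : ∀ v, s ^ 2 * ‖v‖ ^ 2 ≤ ‖U v‖ ^ 2 := fun v => by
    rw [← mul_pow]; exact pow_le_pow_left₀ (by positivity) (hU v) 2
  have e : J v + η • (S (J v) - J (adjoint U (U v) + adjoint J (J v))) =
      J ((1 / 2 : ℝ) • v - η • adjoint U (U v)) + η • S (J v) +
        ((1 / 2 : ℝ) • J v - η • J (adjoint J (J v))) := by
    simp only [map_add, map_sub, map_smul]
    module
  have h1 : ‖J ((1 / 2 : ℝ) • v - η • adjoint U (U v))‖ ≤ j * ((1 / 2 - η * s ^ 2) * ‖v‖) := by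
    refine (hJ _).trans (mul_le_mul_of_nonneg_left ?_ hj)
    refine le_of_sq_le_sq
      (norm_smul_sub_adjoint_sq_le hη hsT (by linarith) hU2 hU' v) ?_
    exact mul_nonneg (by linarith) (norm_nonneg _)
  have h2 : ‖η • S (J v)‖ ≤ η * (m * (j * ‖v‖)) := by
    rw [norm_smul, Real.norm_of_nonneg hη]
    exact mul_le_mul_of_nonneg_left
      ((hS _).trans (mul_le_mul_of_nonneg_left (hJ v) hm)) hη
  have h3 : ‖(1 / 2 : ℝ) • J v - η • J (adjoint J (J v))‖ ≤
      j * (1 / 2 - η * j ^ 2) * ‖v‖ := by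
    refine le_of_sq_le_sq ((norm_smul_sub_cubic_sq_le (sq_nonneg j) hη (by linarith) hJ2 v).trans
      (le_of_eq (by ring))) ?_
    exact mul_nonneg (mul_nonneg hj (by linarith)) (norm_nonneg _)
  rw [e]
  refine (norm_add₃_le).trans ((add_le_add (add_le_add h1 h2) h3).trans (le_of_eq (by ring)))

theorem step_size_cross_term_le {η L D Y : ℝ} (hη : 0 ≤ η) (hY : 0 ≤ Y) (hD : 0 < D)
    (hDL : D ≤ L) (hηL : η * (36 * L ^ 3) ≤ D ^ 2) (hYL : Y ≤ L - D / 2) :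
    η ^ 2 * (18 * L ^ 3 * Y ^ 2) ≤ 169 / 10000 * D ^ 2 * (D / 4) := by
  have hL : 0 < L := by linarith
  have h3 : D * Y ^ 2 ≤ 8 / 27 * L ^ 3 := by
    have : Y ^ 2 ≤ (L - D / 2) ^ 2 := pow_le_pow_left₀ hY (by linarith) 2
    have : D * Y ^ 2 ≤ D * (L - D / 2) ^ 2 := by gcongr
    have : 0 ≤ (3 * D - 2 * L) ^ 2 * (8 * L - 3 * D) :=
      mul_nonneg (sq_nonneg _) (by linarith)
    nlinarith
  have h4 : η ^ 2 * (36 * L ^ 3) ^ 2 ≤ D ^ 4 := by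
    have := pow_le_pow_left₀ (by positivity) hηL 2
    nlinarith
  have hpos : 0 < L ^ 3 * D := by positivity
  refine le_of_mul_le_mul_right ?_ hpos
  calc η ^ 2 * (18 * L ^ 3 * Y ^ 2) * (L ^ 3 * D)
      = η ^ 2 * (18 * L ^ 6) * (D * Y ^ 2) := by ring
    _ ≤ η ^ 2 * (18 * L ^ 6) * (8 / 27 * L ^ 3) := by gcongr
    _ = (η ^ 2 * (36 * L ^ 3) ^ 2) * (1 / 243 * L ^ 3) := by ring
    _ ≤ D ^ 4 * (1 / 243 * L ^ 3) := by gcongr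
    _ ≤ 169 / 10000 * D ^ 2 * (D / 4) * (L ^ 3 * D) := by
      have : 0 ≤ D ^ 4 * L ^ 3 := by positivity
      nlinarith

theorem norm_gd_step_cross_term_le {U : E →ₗ[ℝ] F} {S : F →ₗ[ℝ] F} {η s Y L D : ℝ} {p v : E}
    (hη : 0 ≤ η) (hs : 0 ≤ s) (hY : 0 ≤ Y) (hD : 0 < D) (hDL : D ≤ L)
    (hηL : η * (36 * L ^ 3) ≤ D ^ 2) (hsD : D / 4 ≤ s ^ 2) (hYL : Y ≤ L - D / 2)
    (hS : ∀ y, ‖S y‖ ≤ L * ‖y‖) (hU : ∀ v, ‖U v‖ ^ 2 ≤ 2 * L * ‖v‖ ^ 2) (hp : ‖p‖ ≤ Y * ‖v‖) :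
    ‖(η ^ 2) • (S (U p) - U (adjoint U (U p)))‖ ≤ 13 / 100 * (η * D) * s * ‖v‖ := by
  have hL : 0 < L := by linarith
  have h1 : ‖S (U p) - U (adjoint U (U p))‖ ≤ 3 * L * ‖U p‖ := by
    have a1 := norm_sub_le (S (U p)) (U (adjoint U (U p)))
    have a2 := hS (U p)
    have a3 : ‖U (adjoint U (U p))‖ ≤ 2 * L * ‖U p‖ :=
      norm_apply_adjoint_le (by positivity) hU _
    linarith
  rw [norm_smul, Real.norm_of_nonneg (sq_nonneg η)]
  refine le_of_sq_le_sq ?_ (by positivity)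
  have h2 : (η ^ 2 * ‖S (U p) - U (adjoint U (U p))‖) ^ 2 ≤
      η ^ 4 * (9 * L ^ 2) * (2 * L * (Y * ‖v‖) ^ 2) := by
    calc (η ^ 2 * ‖S (U p) - U (adjoint U (U p))‖) ^ 2
        ≤ (η ^ 2 * (3 * L * ‖U p‖)) ^ 2 := by gcongr
      _ = η ^ 4 * (9 * L ^ 2) * ‖U p‖ ^ 2 := by ring
      _ ≤ η ^ 4 * (9 * L ^ 2) * (2 * L * ‖p‖ ^ 2) := by gcongr; exact hU p
      _ ≤ _ := by gcongr
  refine h2.trans ?_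
  calc η ^ 4 * (9 * L ^ 2) * (2 * L * (Y * ‖v‖) ^ 2)
      = (η ^ 2 * (18 * L ^ 3 * Y ^ 2)) * (η ^ 2 * ‖v‖ ^ 2) := by ring
    _ ≤ (169 / 10000 * D ^ 2 * s ^ 2) * (η ^ 2 * ‖v‖ ^ 2) := by
        refine mul_le_mul_of_nonneg_right ?_ (by positivity)
        exact (step_size_cross_term_le hη hY hD hDL hηL hYL).trans (by gcongr)
    _ = _ := by ring

/-- Lower bound for one gradient step on the top block. -/
theorem le_norm_gd_step {U : E →ₗ[ℝ] F} {J : E →ₗ[ℝ] G} {S : F →ₗ[ℝ] F} {η s Y L l D : ℝ}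
    (hη : 0 ≤ η) (hs : 0 ≤ s) (hY : 0 ≤ Y) (hl : 0 ≤ l) (hlL : l ≤ L) (hD : 0 < D) (hDl : D ≤ l)
    (hηL : η * (36 * L ^ 3) ≤ D ^ 2) (hsD : D / 4 ≤ s ^ 2) (hsL : s ^ 2 ≤ 2 * L)
    (hYl : Y ≤ l - D / 2)
    (hS : ∀ y, ‖S y‖ ≤ L * ‖y‖) (hS' : ∀ y, l * ‖y‖ ^ 2 ≤ ⟪S y, y⟫_ℝ)
    (hJ : ∀ v, ‖J v‖ ^ 2 ≤ Y * ‖v‖ ^ 2) (hU : ∀ v, s * ‖v‖ ≤ ‖U v‖)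
    (hU' : ∀ v, ‖U v‖ ^ 2 ≤ 2 * L * ‖v‖ ^ 2) (v : E) :
    s * ((1 + η * l - 36 / 17 * (η * L) ^ 2) * ((1 - η * s ^ 2) * (1 - η * Y))
      - 13 / 100 * (η * D)) * ‖v‖ ≤
      ‖U v + η • (S (U v) - U (adjoint U (U v) + adjoint J (J v)))‖ := by
  have hL : 0 < L := by linarith
  have hηL1 : η * L ≤ 1 / 36 := by
    have : D ^ 2 ≤ L ^ 2 := pow_le_pow_left₀ hD.le (by linarith) 2
    have : (36 * (η * L)) * L ^ 2 ≤ 1 * L ^ 2 := by nlinarith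
    linarith [le_of_mul_le_mul_right this (by positivity)]
  have hηL0 : 0 ≤ η * L := by positivity
  have hηs : η * s ^ 2 ≤ 2 * (η * L) := by nlinarith
  have hηY : η * Y ≤ η * L := mul_le_mul_of_nonneg_left (by linarith) hη
  have hU2 : ∀ v, s ^ 2 * ‖v‖ ^ 2 ≤ ‖U v‖ ^ 2 := fun v => by
    rw [← mul_pow]; exact pow_le_pow_left₀ (by positivity) (hU v) 2
  set p := adjoint J (J v) with hp
  have hpn : ‖p‖ ≤ Y * ‖v‖ := norm_adjoint_apply_self_le hY hJ v
  set w := v - η • p with hw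
  set y := U w with hy
  set z := y - η • U (adjoint U y) with hz
  have hwn : (1 - η * Y) * ‖v‖ ≤ ‖w‖ := by
    have h1 : ‖v‖ - ‖η • p‖ ≤ ‖w‖ := norm_sub_norm_le _ _
    rw [norm_smul, Real.norm_of_nonneg hη] at h1
    nlinarith [mul_le_mul_of_nonneg_left hpn hη]
  have hzw : s * (1 - η * s ^ 2) * ‖w‖ ≤ ‖z‖ := by
    refine le_of_sq_le_sq (le_trans (le_of_eq ?_) (le_norm_sub_cubic_sq (T := 3 * L)
      (sq_nonneg s) hη (by linarith) (by nlinarith) hU2 (fun v => (hU' v).trans ?_) w))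
      (norm_nonneg _)
    · ring
    · gcongr; norm_num
  have hNy : ‖U (adjoint U y)‖ ≤ 2 * L * ‖y‖ := norm_apply_adjoint_le (by positivity) hU' y
  have hyz : ‖y‖ ≤ 18 / 17 * ‖z‖ := by
    have h1 : ‖y‖ - ‖η • U (adjoint U y)‖ ≤ ‖z‖ := norm_sub_norm_le _ _
    rw [norm_smul, Real.norm_of_nonneg hη] at h1
    nlinarith [mul_le_mul_of_nonneg_left hNy hη,
      mul_le_mul_of_nonneg_right hηL1 (norm_nonneg y)]
  have hSz : (1 + η * l) * ‖z‖ ≤ ‖z + η • S z‖ := by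
    have h1 := real_inner_le_norm (z + η • S z) z
    rw [inner_add_left, inner_smul_left, real_inner_self_eq_norm_sq, conj_trivial] at h1
    have h2 := mul_le_mul_of_nonneg_left (hS' z) hη
    rcases (norm_nonneg z).eq_or_lt with h | h
    · rw [← h, mul_zero]; positivity
    · refine le_of_mul_le_mul_right ?_ h
      nlinarith
  have hErr1 : ‖(η ^ 2) • S (U (adjoint U y))‖ ≤ 36 / 17 * (η * L) ^ 2 * ‖z‖ := by
    rw [norm_smul, Real.norm_of_nonneg (sq_nonneg η)]
    calc η ^ 2 * ‖S (U (adjoint U y))‖ ≤ η ^ 2 * (L * (2 * L * (18 / 17 * ‖z‖))) := by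
          gcongr
          refine (hS _).trans ?_
          gcongr
          refine hNy.trans ?_
          gcongr
      _ = _ := by ring
  have hErr2 : ‖(η ^ 2) • (S (U p) - U (adjoint U (U p)))‖ ≤ 13 / 100 * (η * D) * s * ‖v‖ :=
    norm_gd_step_cross_term_le hη hs hY hD (hDl.trans hlL) hηL hsD (by linarith) hS hU' hpn
  have e : U v + η • (S (U v) - U (adjoint U (U v) + adjoint J (J v))) =
      (z + η • S z) + ((η ^ 2) • S (U (adjoint U y)) +
        (η ^ 2) • (S (U p) - U (adjoint U (U p)))) := by
    rw [hz, hy, hw, ← hp]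
    simp only [map_add, map_sub, map_smul]
    module
  rw [e]
  have k1 : ‖z + η • S z‖ - (‖(η ^ 2) • S (U (adjoint U y))‖ +
      ‖(η ^ 2) • (S (U p) - U (adjoint U (U p)))‖) ≤ _ :=
    (sub_le_sub_left (norm_add_le _ _) _).trans (norm_sub_le_norm_add (z + η • S z) _)
  have hc : 0 ≤ 1 + η * l - 36 / 17 * (η * L) ^ 2 := by
    have : 0 ≤ η * l := by positivity
    nlinarith
  have k2 : s * ((1 - η * s ^ 2) * (1 - η * Y)) * ‖v‖ ≤ ‖z‖ := by
    refine le_trans ?_ hzw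
    have := mul_le_mul_of_nonneg_left hwn (mul_nonneg hs (by linarith : 0 ≤ 1 - η * s ^ 2))
    linarith
  have k3 := mul_le_mul_of_nonneg_left k2 hc
  linarith

end Abstract

theorem norm_toEuclideanLin_le_sigmaMax {m n : ℕ} (M : Matrix (Fin m) (Fin n) ℝ)
    (v : EuclideanSpace ℝ (Fin n)) : ‖M.toEuclideanLin v‖ ≤ sigmaMax M * ‖v‖ := by
  rcases eq_or_ne v 0 with rfl | hv
  · simp
  have hv' : 0 < ‖v‖ := norm_pos_iff.2 hv
  have hbdd : BddAbove {c : ℝ | ∃ v : EuclideanSpace ℝ (Fin n), ‖v‖ = 1 ∧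
      c = ‖M.toEuclideanLin v‖} := by
    refine ⟨‖LinearMap.toContinuousLinearMap M.toEuclideanLin‖, ?_⟩
    rintro c ⟨u, hu, rfl⟩
    simpa [hu] using (LinearMap.toContinuousLinearMap M.toEuclideanLin).le_opNorm u
  have h : ‖M.toEuclideanLin (‖v‖⁻¹ • v)‖ ≤ sigmaMax M :=
    le_csSup hbdd ⟨‖v‖⁻¹ • v, norm_smul_inv_norm (𝕜 := ℝ) hv, rfl⟩
  rw [map_smul, norm_smul, norm_inv, norm_norm, inv_mul_le_iff₀ hv'] at h
  linarith

theorem norm_toEuclideanLin_sq_le {m n : ℕ} {M : Matrix (Fin m) (Fin n) ℝ} {c : ℝ}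
    (h : sigmaMax M ^ 2 ≤ c) (v : EuclideanSpace ℝ (Fin n)) :
    ‖M.toEuclideanLin v‖ ^ 2 ≤ c * ‖v‖ ^ 2 := by
  refine (pow_le_pow_left₀ (norm_nonneg _) (norm_toEuclideanLin_le_sigmaMax M v) 2).trans ?_
  rw [mul_pow]
  gcongr

theorem sigmaMax_le {m n : ℕ} (hn : 0 < n) {M : Matrix (Fin m) (Fin n) ℝ} {c : ℝ}
    (h : ∀ v, ‖M.toEuclideanLin v‖ ≤ c * ‖v‖) : sigmaMax M ≤ c := by
  refine csSup_le ⟨_, EuclideanSpace.single ⟨0, hn⟩ 1, by simp, rfl⟩ ?_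
  rintro _ ⟨v, hv, rfl⟩
  have := h v
  rwa [hv, mul_one] at this

theorem sigmaMax_nonneg {m n : ℕ} (M : Matrix (Fin m) (Fin n) ℝ) : 0 ≤ sigmaMax M :=
  Real.sSup_nonneg (by rintro _ ⟨v, -, rfl⟩; exact norm_nonneg _)

theorem sigmaMin_nonneg {m n : ℕ} (M : Matrix (Fin m) (Fin n) ℝ) : 0 ≤ sigmaMin M :=
  Real.sInf_nonneg (by rintro _ ⟨v, -, rfl⟩; exact norm_nonneg _)

theorem sigmaMin_le_norm_toEuclideanLin {m n : ℕ} (M : Matrix (Fin m) (Fin n) ℝ)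
    (v : EuclideanSpace ℝ (Fin n)) : sigmaMin M * ‖v‖ ≤ ‖M.toEuclideanLin v‖ := by
  rcases eq_or_ne v 0 with rfl | hv
  · simp
  have hv' : 0 < ‖v‖ := norm_pos_iff.2 hv
  have hbdd : BddBelow {c : ℝ | ∃ v : EuclideanSpace ℝ (Fin n), ‖v‖ = 1 ∧
      c = ‖M.toEuclideanLin v‖} := ⟨0, by rintro _ ⟨v, -, rfl⟩; exact norm_nonneg _⟩
  have h : sigmaMin M ≤ ‖M.toEuclideanLin (‖v‖⁻¹ • v)‖ :=
    csInf_le hbdd ⟨‖v‖⁻¹ • v, norm_smul_inv_norm (𝕜 := ℝ) hv, rfl⟩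
  rw [map_smul, norm_smul, norm_inv, norm_norm, le_inv_mul_iff₀ hv'] at h
  linarith

theorem le_sigmaMin {m n : ℕ} (hn : 0 < n) {M : Matrix (Fin m) (Fin n) ℝ} {c : ℝ}
    (h : ∀ v, c * ‖v‖ ≤ ‖M.toEuclideanLin v‖) : c ≤ sigmaMin M := by
  refine le_csInf ⟨_, EuclideanSpace.single ⟨0, hn⟩ 1, by simp, rfl⟩ ?_
  rintro _ ⟨v, hv, rfl⟩
  have := h v
  rwa [hv, mul_one] at this

theorem Fin.sum_univ_castLE_add {d r : ℕ} (h : r ≤ d) (f : Fin d → ℝ) :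
    ∑ i, f i = ∑ i : Fin r, f (Fin.castLE h i) +
      ∑ i : Fin (d - r), f ⟨r + (i : ℕ), by have := i.isLt; omega⟩ := by
  have e : r + (d - r) = d := by omega
  rw [← (finCongr e).sum_comp, Fin.sum_univ_add]
  rfl

theorem norm_topBlock_sq_add_norm_botBlock_sq {d r : ℕ} (h : r ≤ d)
    (X : Matrix (Fin d) (Fin r) ℝ) (v : EuclideanSpace ℝ (Fin r)) :
    ‖(topBlock h X).toEuclideanLin v‖ ^ 2 + ‖(botBlock X).toEuclideanLin v‖ ^ 2 =
      ‖X.toEuclideanLin v‖ ^ 2 := by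
  simp only [EuclideanSpace.real_norm_sq_eq]
  rw [Fin.sum_univ_castLE_add h]
  rfl

theorem sigmaMin_topBlock_sq_le {d r : ℕ} (hr : 0 < r) (h : r ≤ d)
    (X : Matrix (Fin d) (Fin r) ℝ) : sigmaMin (topBlock h X) ^ 2 ≤ sigmaMax X ^ 2 := by
  obtain ⟨v, hv⟩ : ∃ v : EuclideanSpace ℝ (Fin r), ‖v‖ = 1 :=
    ⟨EuclideanSpace.single ⟨0, hr⟩ 1, by simp⟩
  have h1 := sigmaMin_le_norm_toEuclideanLin (topBlock h X) v
  have h2 := norm_toEuclideanLin_le_sigmaMax X v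
  have h3 := norm_topBlock_sq_add_norm_botBlock_sq h X v
  rw [hv, mul_one] at h1 h2
  refine (pow_le_pow_left₀ (sigmaMin_nonneg _) h1 2).trans
    (le_trans ?_ (pow_le_pow_left₀ (norm_nonneg _) h2 2))
  rw [← h3]
  exact le_add_of_nonneg_right (sq_nonneg _)

theorem transpose_mul_self_eq_blocks {d r : ℕ} (h : r ≤ d) (X : Matrix (Fin d) (Fin r) ℝ) :
    Xᵀ * X = (topBlock h X)ᵀ * topBlock h X + (botBlock X)ᵀ * botBlock X := by
  ext i j
  simp only [Matrix.mul_apply, Matrix.add_apply, Matrix.transpose_apply]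
  rw [Fin.sum_univ_castLE_add h]
  rfl

theorem topBlock_gd_step {d r : ℕ} (h : r ≤ d) (lam : Fin d → ℝ) (η : ℝ)
    (X : Matrix (Fin d) (Fin r) ℝ) :
    topBlock h (X + η • ((Matrix.diagonal lam - X * Xᵀ) * X)) =
      topBlock h X + η • (Matrix.diagonal (fun i => lam (Fin.castLE h i)) * topBlock h X -
        topBlock h X * ((topBlock h X)ᵀ * topBlock h X + (botBlock X)ᵀ * botBlock X)) := by
  rw [← transpose_mul_self_eq_blocks, Matrix.sub_mul, Matrix.mul_assoc X]
  ext i j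
  simp [topBlock, Matrix.mul_apply, Matrix.diagonal_apply]

theorem botBlock_gd_step {d r : ℕ} (h : r ≤ d) (lam : Fin d → ℝ) (η : ℝ)
    (X : Matrix (Fin d) (Fin r) ℝ) :
    botBlock (X + η • ((Matrix.diagonal lam - X * Xᵀ) * X)) =
      botBlock X + η • (Matrix.diagonal
        (fun i : Fin (d - r) => lam ⟨r + (i : ℕ), by have := i.isLt; omega⟩) * botBlock X -
        botBlock X * ((topBlock h X)ᵀ * topBlock h X + (botBlock X)ᵀ * botBlock X)) := by
  rw [← transpose_mul_self_eq_blocks, Matrix.sub_mul, Matrix.mul_assoc X]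
  ext i j
  simp [botBlock, Matrix.mul_apply, Matrix.diagonal_apply]

theorem toEuclideanLin_transpose_eq_adjoint {m n : ℕ} (M : Matrix (Fin m) (Fin n) ℝ) :
    Mᵀ.toEuclideanLin = LinearMap.adjoint M.toEuclideanLin := by
  rw [← Matrix.toEuclideanLin_conjTranspose_eq_adjoint, Matrix.conjTranspose_eq_transpose_of_trivial]

theorem toEuclideanLin_gd_step {k l m r : ℕ} (A : Matrix (Fin k) (Fin r) ℝ)
    (B : Matrix (Fin l) (Fin r) ℝ) (C : Matrix (Fin m) (Fin r) ℝ)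
    (S : Matrix (Fin k) (Fin k) ℝ) (η : ℝ) (v : EuclideanSpace ℝ (Fin r)) :
    (A + η • (S * A - A * (Bᵀ * B + Cᵀ * C))).toEuclideanLin v =
      A.toEuclideanLin v + η • (S.toEuclideanLin (A.toEuclideanLin v) - A.toEuclideanLin
        (LinearMap.adjoint B.toEuclideanLin (B.toEuclideanLin v) +
          LinearMap.adjoint C.toEuclideanLin (C.toEuclideanLin v))) := by
  simp only [← toEuclideanLin_transpose_eq_adjoint, map_add, map_sub, map_smul,
    Matrix.toLpLin_mul_same, LinearMap.add_apply, LinearMap.sub_apply, LinearMap.smul_apply,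
    LinearMap.comp_apply, Matrix.mul_add]

theorem norm_toEuclideanLin_diagonal_le {n : ℕ} {f : Fin n → ℝ} {m : ℝ} (hm : 0 ≤ m)
    (h0 : ∀ i, 0 ≤ f i) (h : ∀ i, f i ≤ m) (y : EuclideanSpace ℝ (Fin n)) :
    ‖(Matrix.diagonal f).toEuclideanLin y‖ ≤ m * ‖y‖ := by
  refine le_of_sq_le_sq ?_ (by positivity)
  rw [mul_pow, EuclideanSpace.real_norm_sq_eq, EuclideanSpace.real_norm_sq_eq, Finset.mul_sum]
  refine Finset.sum_le_sum fun i _ => ?_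
  simp only [Matrix.ofLp_toLpLin, Matrix.toLin'_apply, Matrix.mulVec_diagonal, mul_pow]
  gcongr
  exacts [h0 i, h i]

theorem le_inner_toEuclideanLin_diagonal {n : ℕ} {f : Fin n → ℝ} {m : ℝ}
    (h : ∀ i, m ≤ f i) (y : EuclideanSpace ℝ (Fin n)) :
    m * ‖y‖ ^ 2 ≤ inner ℝ ((Matrix.diagonal f).toEuclideanLin y) y := by
  rw [EuclideanSpace.real_norm_sq_eq, PiLp.inner_apply, Finset.mul_sum]
  refine Finset.sum_le_sum fun i _ => ?_
  simp only [Matrix.ofLp_toLpLin, Matrix.toLin'_apply, Matrix.mulVec_diagonal, RCLike.inner_apply,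
    conj_trivial]
  nlinarith [mul_le_mul_of_nonneg_right (h i) (sq_nonneg (y i))]

theorem add_sub_sub_le_gd_factor {u e a b : ℝ} (he : 0 ≤ e) (ha : 0 ≤ a)
    (hb : 0 ≤ b) (hue : e ≤ 1 + u) :
    1 + u - a - b - (e + u * (a + b)) ≤ (1 + u - e) * ((1 - a) * (1 - b)) := by
  have h := mul_nonneg (sub_nonneg.2 hue) (mul_nonneg ha hb)
  have := mul_nonneg he (add_nonneg ha hb)
  nlinarith

theorem sq_le_one_sub_mul_sq {a h : ℝ} (ha0 : 0 ≤ a) (ha : a ≤ 2) (hh0 : 0 ≤ h) (hh : h ≤ 1) :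
    a ^ 2 ≤ (1 - h / 3) * (a + 69 / 100 * h) ^ 2 := by
  have h1 : 0 ≤ h * a * (138 / 100 - a / 3 - 46 / 100 * h) :=
    mul_nonneg (by positivity) (by linarith)
  have h2 : 0 ≤ h ^ 2 * (1 - h / 3) := mul_nonneg (by positivity) (by linarith)
  nlinarith

/-- One gradient step preserves the bound `σ₁(X)² ≤ 2 λ₁`. -/
theorem sigmaMax_gd_step_sq_le {d r : ℕ} (hr : 0 < r) {lam : Fin d → ℝ} {η L : ℝ}
    (h0 : ∀ i, 0 ≤ lam i) (hL : ∀ i, lam i ≤ L) (hLpos : 0 < L) (hη : 0 ≤ η)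
    (hηL : η * L ≤ 1 / 24) {X : Matrix (Fin d) (Fin r) ℝ} (hX : sigmaMax X ^ 2 ≤ 2 * L) :
    sigmaMax (X + η • ((Matrix.diagonal lam - X * Xᵀ) * X)) ^ 2 ≤ 2 * L := by
  have hXv := norm_toEuclideanLin_sq_le hX
  have h : sigmaMax (X + η • ((Matrix.diagonal lam - X * Xᵀ) * X)) ≤
      √(2 * L) * (1 + η * L - η * 0 ^ 2 - η * √(2 * L) ^ 2) := by
    refine sigmaMax_le hr fun v => ?_
    have e : X + η • ((Matrix.diagonal lam - X * Xᵀ) * X) = X + η • (Matrix.diagonal lam * X -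
        X * ((0 : Matrix (Fin d) (Fin r) ℝ)ᵀ * (0 : Matrix (Fin d) (Fin r) ℝ) + Xᵀ * X)) := by
      rw [Matrix.sub_mul, Matrix.mul_assoc X, Matrix.mul_zero, zero_add]
    rw [e, toEuclideanLin_gd_step]
    have hsq : √(2 * L) ^ 2 = 2 * L := Real.sq_sqrt (by positivity)
    refine norm_gd_step_le (T := 3 * L) hη le_rfl (Real.sqrt_nonneg _) (by linarith)
      (by linarith) (by linarith) (norm_toEuclideanLin_diagonal_le hLpos.le h0 hL) hLpos.le
      (fun v => ?_) (fun v => by simp) (fun v => ?_) v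
    · refine le_of_sq_le_sq ?_ (by positivity)
      rw [mul_pow, hsq]
      exact hXv v
    · rw [map_zero, LinearMap.zero_apply, norm_zero, zero_pow two_ne_zero]
      positivity
  have h2 : sigmaMax (X + η • ((Matrix.diagonal lam - X * Xᵀ) * X)) ≤ √(2 * L) := by
    refine h.trans (mul_le_of_le_one_right (Real.sqrt_nonneg _) ?_)
    rw [Real.sq_sqrt (by positivity)]
    nlinarith [mul_nonneg hη hLpos.le]
  exact (pow_le_pow_left₀ (sigmaMax_nonneg _) h2 2).trans
    (Real.sq_sqrt (by positivity)).le

/-- One gradient step keeps the region `R` and contracts the noise-to-signal ratio. -/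
theorem inR_gd_step {d r : ℕ} (hr : 0 < r) (hrd : r ≤ d) {lam : Fin d → ℝ}
    {η L l l' D : ℝ} (h0 : ∀ i, 0 ≤ lam i) (hL : ∀ i, lam i ≤ L)
    (hl : ∀ i : Fin r, l ≤ lam (Fin.castLE hrd i))
    (hl' : ∀ i : Fin (d - r), lam ⟨r + (i : ℕ), by have := i.isLt; omega⟩ ≤ l')
    (hl'0 : 0 ≤ l') (hlL : l ≤ L) (hDdef : D = l - l') (hD : 0 < D) (hη : 0 < η)
    (hηL : η * (36 * L ^ 3) ≤ D ^ 2) {X : Matrix (Fin d) (Fin r) ℝ}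
    (hX : inR hrd L l D X) :
    inR hrd L l D (X + η • ((Matrix.diagonal lam - X * Xᵀ) * X)) ∧
      sigmaMax (botBlock (X + η • ((Matrix.diagonal lam - X * Xᵀ) * X))) ^ 2 /
        sigmaMin (topBlock hrd (X + η • ((Matrix.diagonal lam - X * Xᵀ) * X))) ^ 2 ≤
      (1 - η * D / 3) *
        (sigmaMax (botBlock X) ^ 2 / sigmaMin (topBlock hrd X) ^ 2) := by
  obtain ⟨hX1, hX2, hX3⟩ := hX
  set s := sigmaMin (topBlock hrd X) with hs
  set j := sigmaMax (botBlock X) with hj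
  set X' := X + η • ((Matrix.diagonal lam - X * Xᵀ) * X) with hX'
  have hLpos : 0 < L := by linarith
  have hl0 : 0 ≤ l := by linarith
  have hs0 : 0 ≤ s := sigmaMin_nonneg _
  have hj0 : 0 ≤ j := sigmaMax_nonneg _
  have hXv := norm_toEuclideanLin_sq_le hX1
  have hUv : ∀ v, ‖(topBlock hrd X).toEuclideanLin v‖ ^ 2 ≤ 2 * L * ‖v‖ ^ 2 := fun v => by
    have := norm_topBlock_sq_add_norm_botBlock_sq hrd X v
    linarith [hXv v, sq_nonneg ‖(botBlock X).toEuclideanLin v‖]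
  have hsv := sigmaMin_le_norm_toEuclideanLin (topBlock hrd X)
  have hjv := norm_toEuclideanLin_le_sigmaMax (botBlock X)
  have hsL : s ^ 2 ≤ 2 * L := (sigmaMin_topBlock_sq_le hr hrd X).trans hX1
  have hDL : D ≤ L := by linarith
  have hηL2 : (η * L) * (36 * L) ≤ D := by
    have : D ^ 2 ≤ D * L := by nlinarith
    refine le_of_mul_le_mul_right ?_ hLpos
    nlinarith
  have hηL1 : η * L ≤ 1 / 36 := by
    refine le_of_mul_le_mul_right ?_ hLpos
    linarith
  have hηL0 : 0 < η * L := by positivity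
  have hηD : η * D ≤ η * L := by gcongr
  have hηD0 : 0 < η * D := by positivity
  have hηLsq : 36 * (η * L) ^ 2 ≤ η * D := by
    have := mul_le_mul_of_nonneg_left hηL2 hη.le
    linarith
  have hSbot : ∀ y, ‖(Matrix.diagonal (fun i : Fin (d - r) =>
      lam ⟨r + (i : ℕ), by have := i.isLt; omega⟩)).toEuclideanLin y‖ ≤ l' * ‖y‖ :=
    norm_toEuclideanLin_diagonal_le hl'0 (fun i => h0 _) hl'
  have hbot : ∀ c, 0 ≤ c → j ≤ c → c ^ 2 ≤ l - D / 2 →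
      sigmaMax (botBlock X') ≤ c * (1 + η * l' - η * s ^ 2 - η * c ^ 2) := by
    intro c hc hjc hcl
    refine sigmaMax_le hr fun v => ?_
    rw [hX', botBlock_gd_step hrd, toEuclideanLin_gd_step]
    exact norm_gd_step_le (T := 3 * L) hη.le hs0 hc (by linarith) (by linarith) (by linarith)
      hSbot hl'0 (fun v => (hjv v).trans (by gcongr)) hsv
      (fun v => (hUv v).trans (by gcongr; norm_num)) v
  have htop : ∀ c Y, 0 ≤ c → c ≤ s → D / 4 ≤ c ^ 2 → j ^ 2 ≤ Y → Y ≤ l - D / 2 →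
      c * (1 + η * l - η * c ^ 2 - η * Y - (36 / 17 * (η * L) ^ 2 + η * l * (η * c ^ 2 + η * Y))
        - 13 / 100 * (η * D)) ≤ sigmaMin (topBlock hrd X') := by
    intro c Y hc hcs hcD hjY hYl
    have hY0 : 0 ≤ Y := (sq_nonneg j).trans hjY
    refine le_sigmaMin hr fun v => ?_
    rw [hX', topBlock_gd_step hrd, toEuclideanLin_gd_step]
    refine le_trans ?_ (le_norm_gd_step (L := L) (l := l) (D := D) (Y := Y) (s := c) hη.le hc hY0
      hl0 hlL hD (by linarith) hηL hcD ((pow_le_pow_left₀ hc hcs 2).trans hsL) hYl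
      (norm_toEuclideanLin_diagonal_le hLpos.le (fun i => h0 _) (fun i => hL _))
      (le_inner_toEuclideanLin_diagonal hl) (norm_toEuclideanLin_sq_le hjY)
      (fun v => (mul_le_mul_of_nonneg_right hcs (norm_nonneg v)).trans (hsv v)) hUv v)
    refine mul_le_mul_of_nonneg_right (mul_le_mul_of_nonneg_left ?_ hc) (norm_nonneg v)
    refine sub_le_sub_right (add_sub_sub_le_gd_factor (by positivity) (by positivity)
      (by positivity) ?_) _
    have : 0 ≤ η * l := by positivity
    nlinarith
  have hYpos : 0 ≤ l - D / 2 := by linarith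
  have hηl : η * l ≤ η * L := by gcongr
  have hηl0 : 0 ≤ η * l := by positivity
  have hηl' : η * l' = η * l - η * D := by rw [hDdef]; ring
  have hX1' : sigmaMax X' ^ 2 ≤ 2 * L :=
    sigmaMax_gd_step_sq_le hr h0 hL hLpos hη.le (by linarith) hX1
  have hX2' : sigmaMax (botBlock X') ^ 2 ≤ l - D / 2 := by
    have hsq : √(l - D / 2) ^ 2 = l - D / 2 := Real.sq_sqrt hYpos
    have h := hbot √(l - D / 2) (Real.sqrt_nonneg _) (Real.le_sqrt_of_sq_le hX2) hsq.le
    refine (pow_le_pow_left₀ (sigmaMax_nonneg _)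
      (h.trans (mul_le_of_le_one_right (Real.sqrt_nonneg _) ?_)) 2).trans hsq.le
    rw [hsq]
    nlinarith [mul_nonneg hη.le (sq_nonneg s)]
  have hX3' : D / 4 ≤ sigmaMin (topBlock hrd X') ^ 2 := by
    have hsq : √(D / 4) ^ 2 = D / 4 := Real.sq_sqrt (by positivity)
    have h := htop √(D / 4) (l - D / 2) (Real.sqrt_nonneg _)
      ((Real.sqrt_le_left hs0).2 hX3) hsq.ge hX2 le_rfl
    refine hsq.ge.trans (pow_le_pow_left₀ (Real.sqrt_nonneg _) (le_trans ?_ h) 2)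
    refine le_mul_of_one_le_right (Real.sqrt_nonneg _) ?_
    rw [hsq]
    have : η * l * (η * (D / 4) + η * (l - D / 2)) ≤ (η * L) * (η * L) :=
      mul_le_mul hηl (by linarith)
        (by rw [← mul_add]; exact mul_nonneg hη.le (by linarith)) hηL0.le
    linarith
  refine ⟨⟨hX1', hX2', hX3'⟩, ?_⟩
  have hspos : 0 < s ^ 2 := by linarith
  have hspos' : 0 < sigmaMin (topBlock hrd X') ^ 2 := by linarith
  have hb := hbot j hj0 le_rfl hX2
  have ht := htop s (j ^ 2) hs0 le_rfl hX3 le_rfl hX2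
  set a := 1 + η * l' - η * s ^ 2 - η * j ^ 2 with ha
  have hηs : η * s ^ 2 ≤ 2 * (η * L) := by nlinarith
  have hηj : η * j ^ 2 ≤ η * L := mul_le_mul_of_nonneg_left (by linarith) hη.le
  have hηs0 : 0 ≤ η * s ^ 2 := by positivity
  have hηj0 : 0 ≤ η * j ^ 2 := by positivity
  have ha0 : 0 < a := by
    have : 0 ≤ η * l' := by positivity
    linarith
  have ha1 : a ≤ 2 := by linarith
  have ht' : s * (a + 69 / 100 * (η * D)) ≤ sigmaMin (topBlock hrd X') := by
    refine le_trans (mul_le_mul_of_nonneg_left ?_ hs0) ht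
    have : η * l * (η * s ^ 2 + η * j ^ 2) ≤ (η * L) * (3 * (η * L)) :=
      mul_le_mul hηl (by linarith) (by linarith) hηL0.le
    linarith
  have hb2 := pow_le_pow_left₀ (sigmaMax_nonneg _) hb 2
  have ht2 := pow_le_pow_left₀ (by positivity) ht' 2
  have hkey := sq_le_one_sub_mul_sq ha0.le ha1 hηD0.le (by linarith : η * D ≤ 1)
  rw [← mul_div_assoc, div_le_div_iff₀ hspos' hspos]
  calc sigmaMax (botBlock X') ^ 2 * s ^ 2 ≤ (j * a) ^ 2 * s ^ 2 := by gcongr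
    _ = j ^ 2 * s ^ 2 * a ^ 2 := by ring
    _ ≤ j ^ 2 * s ^ 2 * ((1 - η * D / 3) * (a + 69 / 100 * (η * D)) ^ 2) := by gcongr
    _ = (1 - η * D / 3) * j ^ 2 * (s * (a + 69 / 100 * (η * D))) ^ 2 := by ring
    _ ≤ (1 - η * D / 3) * j ^ 2 * sigmaMin (topBlock hrd X') ^ 2 := by
        refine mul_le_mul_of_nonneg_left ht2 (mul_nonneg (by linarith) (sq_nonneg _))

/-- Lemma 2.3: linear contraction of the noise-to-signal ratio, and the resulting
linear convergence of `σ₁(J_t)²` to zero. -/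
theorem noise_to_signal_contraction (d r : ℕ) (hr : 0 < r) (hrd : r < d)
    (lam : Fin d → ℝ)
    (hmono : ∀ i j : Fin d, i ≤ j → lam j ≤ lam i)
    (hnn : ∀ i, 0 ≤ lam i)
    (η : ℝ) (hη : 0 < η)
    (hΔ : 0 < lam ⟨r - 1, by omega⟩ - lam ⟨r, hrd⟩)
    (hηle : η ≤ (lam ⟨r - 1, by omega⟩ - lam ⟨r, hrd⟩) ^ 2 / (36 * lam ⟨0, by omega⟩ ^ 3))
    (X0 : Matrix (Fin d) (Fin r) ℝ)
    (hX0 : inR hrd.le (lam ⟨0, by omega⟩) (lam ⟨r - 1, by omega⟩)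
      (lam ⟨r - 1, by omega⟩ - lam ⟨r, hrd⟩) X0) :
    (∀ t : ℕ,
      sigmaMax (botBlock (gdIter (Matrix.diagonal lam) η X0 (t + 1))) ^ 2 /
          sigmaMin (topBlock hrd.le (gdIter (Matrix.diagonal lam) η X0 (t + 1))) ^ 2 ≤
        (1 - η * (lam ⟨r - 1, by omega⟩ - lam ⟨r, hrd⟩) / 3) *
          (sigmaMax (botBlock (gdIter (Matrix.diagonal lam) η X0 t)) ^ 2 /
            sigmaMin (topBlock hrd.le (gdIter (Matrix.diagonal lam) η X0 t)) ^ 2)) ∧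
    (∀ t : ℕ,
      sigmaMax (botBlock (gdIter (Matrix.diagonal lam) η X0 t)) ^ 2 ≤
        (8 * lam ⟨0, by omega⟩ ^ 2 / (lam ⟨r - 1, by omega⟩ - lam ⟨r, hrd⟩)) *
          (1 - η * (lam ⟨r - 1, by omega⟩ - lam ⟨r, hrd⟩) / 3) ^ t) := by
  set L := lam ⟨0, by omega⟩
  set l := lam ⟨r - 1, by omega⟩
  set l' := lam ⟨r, hrd⟩
  have hl'0 : 0 ≤ l' := hnn _
  have hlL : l ≤ L := hmono _ _ (Fin.mk_le_mk.2 (Nat.zero_le _))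
  have hLpos : 0 < L := by linarith
  have hηL : η * (36 * L ^ 3) ≤ (l - l') ^ 2 := (le_div_iff₀ (by positivity)).1 hηle
  have step := fun X hX => inR_gd_step (X := X) hr hrd.le hnn
    (fun i => hmono _ i (Fin.mk_le_mk.2 (Nat.zero_le _)))
    (fun i => hmono _ _ (Fin.mk_le_mk.2 (by have := i.isLt; omega)))
    (fun i => hmono _ _ (Fin.mk_le_mk.2 (by omega))) hl'0 hlL rfl hΔ hη hηL hX
  have hR : ∀ t, inR hrd.le L l (l - l') (gdIter (Matrix.diagonal lam) η X0 t) := by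
    intro t
    induction t with
    | zero => exact hX0
    | succ t ih => exact (step _ ih).1
  have hcontr := fun t => (step _ (hR t)).2
  refine ⟨hcontr, fun t => ?_⟩
  have hηD : η * (l - l') ≤ 1 := by
    have h1 : (l - l') ^ 3 ≤ L ^ 3 := pow_le_pow_left₀ hΔ.le (by linarith) 3
    have h2 : η * (l - l') * (l - l') ^ 2 ≤ 1 * (l - l') ^ 2 := by
      nlinarith [mul_le_mul_of_nonneg_left h1 hη.le, mul_pos hη (pow_pos hLpos 3)]
    exact le_of_mul_le_mul_right h2 (by positivity)
  have hq : 0 ≤ 1 - η * (l - l') / 3 := by linarith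
  have hratio : ∀ t, sigmaMax (botBlock (gdIter (Matrix.diagonal lam) η X0 t)) ^ 2 /
      sigmaMin (topBlock hrd.le (gdIter (Matrix.diagonal lam) η X0 t)) ^ 2 ≤
      (1 - η * (l - l') / 3) ^ t * (4 * L / (l - l')) := by
    intro t
    induction t with
    | zero =>
      obtain ⟨-, h2, h3⟩ := hX0
      have h4 : sigmaMax (botBlock X0) ^ 2 / sigmaMin (topBlock hrd.le X0) ^ 2 ≤
          L / ((l - l') / 4) := by
        gcongr
        linarith
      rw [pow_zero, one_mul]
      exact h4.trans (le_of_eq (by field_simp))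
    | succ t ih =>
      refine (hcontr t).trans ((mul_le_mul_of_nonneg_left ih hq).trans (le_of_eq ?_))
      ring
  obtain ⟨h1, -, h3⟩ := hR t
  have hs := sigmaMin_topBlock_sq_le hr hrd.le (gdIter (Matrix.diagonal lam) η X0 t)
  have hspos : 0 < sigmaMin (topBlock hrd.le (gdIter (Matrix.diagonal lam) η X0 t)) ^ 2 := by
    linarith
  refine ((div_le_iff₀ hspos).1 (hratio t)).trans ?_
  calc (1 - η * (l - l') / 3) ^ t * (4 * L / (l - l')) *
        sigmaMin (topBlock hrd.le (gdIter (Matrix.diagonal lam) η X0 t)) ^ 2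
      ≤ (1 - η * (l - l') / 3) ^ t * (4 * L / (l - l')) * (2 * L) := by
        gcongr
        exact hs.trans h1
    _ = 8 * L ^ 2 / (l - l') * (1 - η * (l - l') / 3) ^ t := by ring
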